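/- Suppose the action of G_A on Y is regular, i.e., every permutation of Y induced by an element of G_A has all its cycles of the same length. Then for every ω ∈ Ω̂, the spinal group G_ω is periodic; moreover, the order of every element of G_ω divides some power of q. -/

import Mathlib

noncomputable section

open Equiv

namespace Spinal

/-- The letter `q` of the alphabet `{1,…,q}` (here `q = m + 2`). -/
def qtop (m : ℕ) : Fin (m + 2) := Fin.last (m + 1)

/-- The letter `1` of the alphabet. -/
def qone (m : ℕ) : Fin (m + 2) := 0


theorem qone_ne_qtop (m : ℕ) : qone m ≠ qtop m := by
  simp [qone, qtop, Fin.ext_iff]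

/-- The action of an alphabet permutation on the first letter of a word. -/
def rootFun (m : ℕ) (a : Equiv.Perm (Fin (m + 2))) :
    List (Fin (m + 2)) → List (Fin (m + 2))
  | [] => []
  | y :: w => a y :: w

theorem rootFun_leftInv (m : ℕ) (a : Equiv.Perm (Fin (m + 2))) (w : List (Fin (m + 2))) :
    rootFun m a.symm (rootFun m a w) = w := by
  cases w <;> simp [rootFun]

/-- The tree automorphism induced by a root permutation. -/
def rootAut (m : ℕ) (a : Equiv.Perm (Fin (m + 2))) : Equiv.Perm (List (Fin (m + 2))) where
  toFun := rootFun m a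
  invFun := rootFun m a.symm
  left_inv w := rootFun_leftInv m a w
  right_inv w := by simpa using rootFun_leftInv m a.symm w

variable {GB : Type*} [Group GB]

/-- The spinal action of `b : G_B` determined by the sequence `ω` of homomorphisms:
at the vertex `q^n 1` the next letter is moved by `ω n b` (0-indexed, so `ω 0` is the
paper's `ω₁`). -/
def spinalFun (m : ℕ) (ω : ℕ → GB →* Equiv.Perm (Fin (m + 2))) (b : GB) :
    ℕ → List (Fin (m + 2)) → List (Fin (m + 2))
  | _, [] => []
  | n, y :: w =>
    if y = qtop m then y :: spinalFun m ω b (n + 1) w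
    else if y = qone m then
      y :: (match w with
            | [] => []
            | z :: w' => ω n b z :: w')
    else y :: w

theorem spinalFun_leftInv (m : ℕ) (ω : ℕ → GB →* Equiv.Perm (Fin (m + 2)))
    (b : GB) (n : ℕ) (w : List (Fin (m + 2))) :
    spinalFun m ω b⁻¹ n (spinalFun m ω b n w) = w := by
  induction w generalizing n with
  | nil => simp [spinalFun]
  | cons y w ih =>
    by_cases h1 : y = qtop m
    · simp [spinalFun, h1, ih]
    · by_cases h2 : y = qone m
      · match w with
        | [] => simp [spinalFun, h1, h2]
        | z :: w' => simp [spinalFun, h1, h2, map_inv, qone_ne_qtop]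
      · simp [spinalFun, h1, h2]

/-- The tree automorphism induced by `b : G_B` via the sequence `ω`. -/
def spinalAut (m : ℕ) (ω : ℕ → GB →* Equiv.Perm (Fin (m + 2))) (b : GB) :
    Equiv.Perm (List (Fin (m + 2))) where
  toFun := spinalFun m ω b 0
  invFun := spinalFun m ω b⁻¹ 0
  left_inv w := spinalFun_leftInv m ω b 0 w
  right_inv w := by simpa using spinalFun_leftInv m ω b⁻¹ 0 w

/-- The canonical generating set `S_ω = A ∪ B_ω` (non-identity induced automorphisms). -/
def genSet (m : ℕ) (GA : Subgroup (Equiv.Perm (Fin (m + 2))))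
    (ω : ℕ → GB →* Equiv.Perm (Fin (m + 2))) : Set (Equiv.Perm (List (Fin (m + 2)))) :=
  ((rootAut m '' (GA : Set (Equiv.Perm (Fin (m + 2))))) ∪
    Set.range fun b : GB => spinalAut m ω b) \ {1}

/-- The spinal group `G_ω`, as a subgroup of the permutation group of the vertex set
of the `(m+2)`-regular rooted tree. -/
def spinalGroup (m : ℕ) (GA : Subgroup (Equiv.Perm (Fin (m + 2))))
    (ω : ℕ → GB →* Equiv.Perm (Fin (m + 2))) : Subgroup (Equiv.Perm (List (Fin (m + 2)))) :=
  Subgroup.closure (genSet m GA ω)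

/-- The defining conditions on the data `(G_A, G_B, ω)` of a spinal group:
`G_A` is a transitive (hence faithful) group of permutations of the alphabet,
every `ω n` is an epimorphism onto `G_A`, and `ω ∈ Ω̂`: from every index on, the kernels
of the remaining homomorphisms cover `G_B` and intersect trivially. -/
structure SpinalData (m : ℕ) (GA : Subgroup (Equiv.Perm (Fin (m + 2))))
    (ω : ℕ → GB →* Equiv.Perm (Fin (m + 2))) : Prop where
  transitive : ∀ i j : Fin (m + 2), ∃ a ∈ GA, a i = j
  range_eq : ∀ n, (ω n).range = GA
  kernels_cover : ∀ i : ℕ, ∀ b : GB, ∃ j, i ≤ j ∧ ω j b = 1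
  kernels_sep : ∀ i : ℕ, ∀ b : GB, (∀ j, i ≤ j → ω j b = 1) → b = 1

/-- Word length of a group element with respect to a set of generators. -/
def wordLength {G : Type*} [Group G] (S : Set G) (g : G) : ℕ :=
  sInf {n | ∃ l : List G, l.length = n ∧ (∀ x ∈ l, x ∈ S) ∧ l.prod = g}

/-- The word growth function `γ_ω` of the spinal group with respect to `S_ω`. -/
def growth (m : ℕ) (GA : Subgroup (Equiv.Perm (Fin (m + 2))))
    (ω : ℕ → GB →* Equiv.Perm (Fin (m + 2))) (n : ℕ) : ℕ :=
  Nat.card {g : Equiv.Perm (List (Fin (m + 2))) //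
    g ∈ spinalGroup m GA ω ∧ wordLength (genSet m GA ω) g ≤ n}

/-- The period growth function `π_ω`: the largest order of an element of word length
at most `n`. -/
def periodGrowth (m : ℕ) (GA : Subgroup (Equiv.Perm (Fin (m + 2))))
    (ω : ℕ → GB →* Equiv.Perm (Fin (m + 2))) (n : ℕ) : ℕ :=
  sSup (orderOf '' {g : Equiv.Perm (List (Fin (m + 2))) |
    g ∈ spinalGroup m GA ω ∧ wordLength (genSet m GA ω) g ≤ n})

/-- Abstract letters for words over `S_ω`: an `A`-letter is (induced by) a permutation
of the alphabet, a `B`-letter is (induced by) an element of `G_B`. -/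
abbrev Letter (m : ℕ) (GB : Type*) := Equiv.Perm (Fin (m + 2)) ⊕ GB

/-- Evaluation of an abstract letter as a tree automorphism. -/
def evalLetter (m : ℕ) (ω : ℕ → GB →* Equiv.Perm (Fin (m + 2))) :
    Letter m GB → Equiv.Perm (List (Fin (m + 2))) :=
  Sum.elim (rootAut m) (spinalAut m ω)

/-- The list of `A`-letters of a word, in order. -/
def aLetters {m : ℕ} {GB : Type*} : List (Letter m GB) → List (Equiv.Perm (Fin (m + 2))) :=
  List.filterMap fun x => match x with
    | Sum.inl a => some a
    | Sum.inr _ => none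

/-- The list of `B`-letters of a word, in order. -/
def bLetters {m : ℕ} {GB : Type*} : List (Letter m GB) → List GB :=
  List.filterMap fun x => match x with
    | Sum.inl _ => none
    | Sum.inr b => some b

/-- A word is reduced if its letters alternate between `A`-letters and `B`-letters and
no letter is the identity. -/
def IsReduced {m : ℕ} (F : List (Letter m GB)) : Prop :=
  List.Chain' (fun x y => x.isLeft ≠ y.isLeft) F ∧
    Sum.inl (1 : Equiv.Perm (Fin (m + 2))) ∉ F ∧ Sum.inr (1 : GB) ∉ F

open scoped Classical in
/-- One step of the (complete, confluent) simple reduction process: prepend a letter to an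
already reduced word and reduce. -/
def reduceStep {m : ℕ} : Letter m GB → List (Letter m GB) → List (Letter m GB)
  | Sum.inl a, [] => if a = 1 then [] else [Sum.inl a]
  | Sum.inr b, [] => if b = 1 then [] else [Sum.inr b]
  | Sum.inl a, Sum.inl a' :: t => if a * a' = 1 then t else Sum.inl (a * a') :: t
  | Sum.inr b, Sum.inr b' :: t => if b * b' = 1 then t else Sum.inr (b * b') :: t
  | Sum.inl a, y :: t => if a = 1 then y :: t else Sum.inl a :: y :: t
  | Sum.inr b, y :: t => if b = 1 then y :: t else Sum.inr b :: y :: t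

/-- The reduced form of a word, obtained by simple reductions. -/
def reduceWord {m : ℕ} (F : List (Letter m GB)) : List (Letter m GB) :=
  F.foldr reduceStep []

open scoped Classical in
/-- The (unreduced) projection of a word, representing an element of the first-level
stabilizer, to the coordinate `i` of the first level: scanning the word from the left
while accumulating the product `g` of the `A`-letters, a `B`-letter `b` contributes the
letter `b` at the coordinate `g(q)` and the letter `ω₁(b)` at the coordinate `g(1)`. -/
def projWord (m : ℕ) (ω0 : GB →* Equiv.Perm (Fin (m + 2))) (i : Fin (m + 2)) :
    List (Letter m GB) → Equiv.Perm (Fin (m + 2)) → List (Letter m GB)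
  | [], _ => []
  | Sum.inl a :: F, g => projWord m ω0 i F (g * a)
  | Sum.inr b :: F, g =>
      ((if g (qtop m) = i then [Sum.inr b] else []) ++
        (if g (qone m) = i then [Sum.inl (ω0 b)] else [])) ++ projWord m ω0 i F g

/-- The list of the `q^r` (reduced) words at level `r` of the depth-`r` decomposition
of a word. -/
def levelWords (m : ℕ) :
    (ℕ → GB →* Equiv.Perm (Fin (m + 2))) → ℕ → List (Letter m GB) →
      List (List (Letter m GB))
  | _, 0, F => [F]
  | ω, r + 1, F =>
      (List.finRange (m + 2)).flatMap fun i =>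
        levelWords m (fun n => ω (n + 1)) r (reduceWord (projWord m (ω 0) i F 1))

/-- `|L_r(F)|`: the total length of level `r` of the depth-`r` decomposition of `F`. -/
def levelLength (m : ℕ) (ω : ℕ → GB →* Equiv.Perm (Fin (m + 2))) (r : ℕ)
    (F : List (Letter m GB)) : ℕ :=
  ((levelWords m ω r F).map List.length).sum

/-- The triangular weight of a letter: `A`-letters have weight `τ₀ = 1 - η^r`; a
`B`-letter `b` has weight `τ_i = η^r + η^(r-i) - 1` where `i` is the smallest (1-based)
index with `ω_i(b) = 1`. -/
def letterWeight (m : ℕ) (ω : ℕ → GB →* Equiv.Perm (Fin (m + 2))) (η : ℝ) (r : ℕ) :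
    Letter m GB → ℝ
  | Sum.inl _ => 1 - η ^ r
  | Sum.inr b => η ^ r + η ^ (r - (sInf {j | ω j b = 1} + 1)) - 1

/-- The total triangular weight of a word. -/
def wordWeight (m : ℕ) (ω : ℕ → GB →* Equiv.Perm (Fin (m + 2))) (η : ℝ) (r : ℕ)
    (F : List (Letter m GB)) : ℝ :=
  (F.map (letterWeight m ω η r)).sum

/-- The weight `∂^τ(g)` of a group element: the least total weight of a word over `S_ω`
representing it. -/
def elemWeight (m : ℕ) (GA : Subgroup (Equiv.Perm (Fin (m + 2))))
    (ω : ℕ → GB →* Equiv.Perm (Fin (m + 2))) (η : ℝ) (r : ℕ)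
    (g : Equiv.Perm (List (Fin (m + 2)))) : ℝ :=
  sInf {x : ℝ | ∃ F : List (Letter m GB),
    (∀ a : Equiv.Perm (Fin (m + 2)), Sum.inl a ∈ F → a ∈ GA) ∧
    (F.map (evalLetter m ω)).prod = g ∧ wordWeight m ω η r F = x}

theorem countP_lt_countP_of_imp {α : Type*} {p p' : α → Bool} {l : List α} {x : α} (hx : x ∈ l)
    (himp : ∀ y, p y → p' y) (hx' : p' x) (hpx : ¬ p x) : l.countP p < l.countP p' := by
  obtain ⟨s, t, rfl⟩ := List.append_of_mem hx
  have hs : s.countP p ≤ s.countP p' := List.countP_mono_left fun y _ => himp y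
  have ht : t.countP p ≤ t.countP p' := List.countP_mono_left fun y _ => himp y
  simp only [List.countP_append, List.countP_cons, hx', hpx, if_true]
  simp only [Bool.false_eq_true, if_false]
  omega

/-- The group element represented by a word. -/
def evalWord (m : ℕ) (ω : ℕ → GB →* Equiv.Perm (Fin (m + 2))) (F : List (Letter m GB)) :
    Equiv.Perm (List (Fin (m + 2))) :=
  (F.map (evalLetter m ω)).prod

/-- The permutation of the first level induced by a word. -/
def wordPerm {m : ℕ} (F : List (Letter m GB)) : Equiv.Perm (Fin (m + 2)) :=
  (F.map (Sum.elim id fun _ => 1)).prod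

open scoped Classical in
/-- The section of a letter at a vertex of the first level. -/
def letterSection {m : ℕ} (ω0 : GB →* Equiv.Perm (Fin (m + 2))) :
    Letter m GB → Fin (m + 2) → List (Letter m GB)
  | Sum.inl _, _ => []
  | Sum.inr b, y =>
    if y = qtop m then [Sum.inr b]
    else if y = qone m ∧ ω0 b ≠ 1 then [Sum.inl (ω0 b)] else []

/-- The section of a word at a vertex of the first level. -/
def wordSection {m : ℕ} (ω0 : GB →* Equiv.Perm (Fin (m + 2))) :
    List (Letter m GB) → Fin (m + 2) → List (Letter m GB)
  | [], _ => []
  | x :: F, y => letterSection ω0 x (wordPerm F y) ++ wordSection ω0 F y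

/-- The section of the `n`-th power of a word at a vertex of the first level. -/
def powSection {m : ℕ} (ω0 : GB →* Equiv.Perm (Fin (m + 2))) (F : List (Letter m GB)) :
    ℕ → Fin (m + 2) → List (Letter m GB)
  | 0, _ => []
  | n + 1, y => wordSection ω0 F ((wordPerm F ^ n) y) ++ powSection ω0 F n y

/-- All `A`-letters of the word belong to the root group. -/
def IsWordOver {m : ℕ} (GA : Subgroup (Equiv.Perm (Fin (m + 2)))) (F : List (Letter m GB)) : Prop :=
  ∀ a, Sum.inl a ∈ F → a ∈ GA

/-- The order of `g` divides a power of `q`. -/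
def HasPowOrder {G : Type*} [Group G] (q : ℕ) (g : G) : Prop :=
  ∃ k : ℕ, g ^ q ^ k = 1

theorem HasPowOrder.of_conj {G : Type*} [Group G] {q : ℕ} {g c : G}
    (h : HasPowOrder q (c * g * c⁻¹)) : HasPowOrder q g := by
  obtain ⟨k, hk⟩ := h
  refine ⟨k, ?_⟩
  rwa [conj_pow, conj_eq_one_iff] at hk

@[simp] theorem evalWord_nil (m : ℕ) (ω : ℕ → GB →* Equiv.Perm (Fin (m + 2))) :
    evalWord m ω [] = 1 := rfl

@[simp] theorem evalWord_cons (m : ℕ) (ω : ℕ → GB →* Equiv.Perm (Fin (m + 2)))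
    (x : Letter m GB) (F : List (Letter m GB)) :
    evalWord m ω (x :: F) = evalLetter m ω x * evalWord m ω F := by
  simp [evalWord]

@[simp] theorem evalWord_append (m : ℕ) (ω : ℕ → GB →* Equiv.Perm (Fin (m + 2)))
    (F F' : List (Letter m GB)) :
    evalWord m ω (F ++ F') = evalWord m ω F * evalWord m ω F' := by
  simp [evalWord]

theorem rootAut_one (m : ℕ) : rootAut m 1 = 1 := by
  ext1 w
  cases w <;> simp [rootAut, rootFun]

theorem rootAut_mul (m : ℕ) (a a' : Equiv.Perm (Fin (m + 2))) :
    rootAut m (a * a') = rootAut m a * rootAut m a' := by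
  ext1 w
  cases w <;> simp [rootAut, rootFun]

theorem spinalFun_one (m : ℕ) (ω : ℕ → GB →* Equiv.Perm (Fin (m + 2))) (n : ℕ)
    (w : List (Fin (m + 2))) : spinalFun m ω 1 n w = w := by
  induction w generalizing n with
  | nil => rfl
  | cons y w ih =>
    simp only [spinalFun, ih]
    cases w <;> simp

theorem spinalFun_mul (m : ℕ) (ω : ℕ → GB →* Equiv.Perm (Fin (m + 2))) (b c : GB) (n : ℕ)
    (w : List (Fin (m + 2))) :
    spinalFun m ω (b * c) n w = spinalFun m ω b n (spinalFun m ω c n w) := by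
  induction w generalizing n with
  | nil => rfl
  | cons y w ih =>
    by_cases h1 : y = qtop m
    · simp [spinalFun, h1, ih]
    · by_cases h2 : y = qone m
      · cases w <;> simp [spinalFun, h2, qone_ne_qtop]
      · simp [spinalFun, h1, h2]

theorem spinalFun_succ (m : ℕ) (ω : ℕ → GB →* Equiv.Perm (Fin (m + 2))) (b : GB) (n : ℕ)
    (w : List (Fin (m + 2))) :
    spinalFun m ω b (n + 1) w = spinalFun m (fun j => ω (j + 1)) b n w := by
  induction w generalizing n with
  | nil => rfl
  | cons y w ih => simp only [spinalFun, ih]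

/-- The root action as a homomorphism. -/
def rootHom (m : ℕ) : Equiv.Perm (Fin (m + 2)) →* Equiv.Perm (List (Fin (m + 2))) where
  toFun := rootAut m
  map_one' := rootAut_one m
  map_mul' := rootAut_mul m

/-- The spinal action as a homomorphism. -/
def spinalHom (m : ℕ) (ω : ℕ → GB →* Equiv.Perm (Fin (m + 2))) :
    GB →* Equiv.Perm (List (Fin (m + 2))) where
  toFun := spinalAut m ω
  map_one' := Equiv.ext fun w => spinalFun_one m ω 0 w
  map_mul' b c := Equiv.ext fun w => spinalFun_mul m ω b c 0 w

theorem evalLetter_inl (m : ℕ) (ω : ℕ → GB →* Equiv.Perm (Fin (m + 2)))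
    (a : Equiv.Perm (Fin (m + 2))) : evalLetter m ω (Sum.inl a) = rootHom m a := rfl

theorem evalLetter_inr (m : ℕ) (ω : ℕ → GB →* Equiv.Perm (Fin (m + 2))) (b : GB) :
    evalLetter m ω (Sum.inr b) = spinalHom m ω b := rfl

theorem evalLetter_apply_cons (m : ℕ) (ω : ℕ → GB →* Equiv.Perm (Fin (m + 2)))
    (x : Letter m GB) (y : Fin (m + 2)) (w : List (Fin (m + 2))) :
    evalLetter m ω x (y :: w) = Sum.elim id (fun _ => 1) x y ::
      evalWord m (fun j => ω (j + 1)) (letterSection (ω 0) x y) w := by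
  rcases x with a | b
  · rfl
  · change spinalFun m ω b 0 (y :: w) = _
    by_cases h1 : y = qtop m
    · simp [spinalFun, letterSection, h1, spinalFun_succ, evalLetter, spinalAut]
    · by_cases h2 : y = qone m
      · by_cases h3 : ω 0 b = 1
        · cases w <;> simp [spinalFun, letterSection, h2, h3, qone_ne_qtop]
        · cases w <;>
            simp [spinalFun, letterSection, h2, h3, qone_ne_qtop, evalLetter, rootAut, rootFun]
      · simp [spinalFun, letterSection, h1, h2]

theorem evalWord_apply_cons (m : ℕ) (ω : ℕ → GB →* Equiv.Perm (Fin (m + 2)))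
    (F : List (Letter m GB)) (y : Fin (m + 2)) (w : List (Fin (m + 2))) :
    evalWord m ω F (y :: w) = wordPerm F y ::
      evalWord m (fun j => ω (j + 1)) (wordSection (ω 0) F y) w := by
  induction F with
  | nil => rfl
  | cons x F ih =>
    rw [evalWord_cons, Equiv.Perm.mul_apply, ih, evalLetter_apply_cons]
    simp [wordSection, wordPerm]

theorem evalWord_pow_apply_cons (m : ℕ) (ω : ℕ → GB →* Equiv.Perm (Fin (m + 2)))
    (F : List (Letter m GB)) (n : ℕ) (y : Fin (m + 2)) (w : List (Fin (m + 2))) :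
    (evalWord m ω F ^ n) (y :: w) = (wordPerm F ^ n) y ::
      evalWord m (fun j => ω (j + 1)) (powSection (ω 0) F n y) w := by
  induction n with
  | zero => rfl
  | succ n ih =>
    rw [pow_succ', Equiv.Perm.mul_apply, ih, evalWord_apply_cons, pow_succ']
    simp [powSection]

theorem evalWord_apply_nil (m : ℕ) (ω : ℕ → GB →* Equiv.Perm (Fin (m + 2)))
    (F : List (Letter m GB)) : evalWord m ω F [] = [] := by
  induction F with
  | nil => rfl
  | cons x F ih =>
    rw [evalWord_cons, Equiv.Perm.mul_apply, ih]
    cases x <;> rfl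

theorem SpinalData.shift {m : ℕ} {GA : Subgroup (Equiv.Perm (Fin (m + 2)))}
    {ω : ℕ → GB →* Equiv.Perm (Fin (m + 2))} (h : SpinalData m GA ω) :
    SpinalData m GA fun j => ω (j + 1) where
  transitive := h.transitive
  range_eq n := h.range_eq (n + 1)
  kernels_cover i b := by
    obtain ⟨j, hj, hb⟩ := h.kernels_cover (i + 1) b
    refine ⟨j - 1, by omega, ?_⟩
    rwa [show j - 1 + 1 = j by omega]
  kernels_sep i b hb := by
    refine h.kernels_sep (i + 1) b fun j hj => ?_
    have := hb (j - 1) (by omega)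
    rwa [show j - 1 + 1 = j by omega] at this

theorem SpinalData.map_mem {m : ℕ} {GA : Subgroup (Equiv.Perm (Fin (m + 2)))}
    {ω : ℕ → GB →* Equiv.Perm (Fin (m + 2))} (h : SpinalData m GA ω) (n : ℕ) (b : GB) :
    ω n b ∈ GA :=
  h.range_eq n ▸ ⟨b, rfl⟩

theorem SpinalData.pow_eq_one {m : ℕ} {GA : Subgroup (Equiv.Perm (Fin (m + 2)))}
    {ω : ℕ → GB →* Equiv.Perm (Fin (m + 2))} (h : SpinalData m GA ω)
    (hreg : ∀ a ∈ GA, ∀ y z : Fin (m + 2),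
      Function.minimalPeriod (⇑a) y = Function.minimalPeriod (⇑a) z)
    {a : Equiv.Perm (Fin (m + 2))} (ha : a ∈ GA) : a ^ (m + 2) = 1 := by
  have hfree : ∀ c ∈ GA, c 0 = 0 → c = 1 := by
    intro c hc h0
    ext1 y
    have h1 : Function.minimalPeriod (⇑c) 0 = 1 :=
      Function.minimalPeriod_eq_one_iff_isFixedPt.2 h0
    exact Function.minimalPeriod_eq_one_iff_isFixedPt.1 ((hreg c hc y 0).trans h1)
  have hbij : Function.Bijective fun c : GA => (c : Equiv.Perm (Fin (m + 2))) 0 := by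
    constructor
    · intro c c' hcc
      have := hfree (c⁻¹ * c' : GA) (c⁻¹ * c').2 (by
        simp only [Subgroup.coe_mul, Equiv.Perm.mul_apply]
        exact Equiv.Perm.inv_eq_iff_eq.2 hcc.symm)
      exact inv_mul_eq_one.1 (Subtype.ext this)
    · intro y
      obtain ⟨c, hc, hy⟩ := h.transitive 0 y
      exact ⟨⟨c, hc⟩, hy⟩
  have hcard : Nat.card GA = m + 2 := by
    rw [Nat.card_congr (Equiv.ofBijective _ hbij), Nat.card_fin]
  have := pow_card_eq_one' (x := (⟨a, ha⟩ : GA))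
  rw [hcard] at this
  exact congrArg Subtype.val this

theorem SpinalData.hasPowOrder_spinalHom {m : ℕ} {GA : Subgroup (Equiv.Perm (Fin (m + 2)))}
    {ω : ℕ → GB →* Equiv.Perm (Fin (m + 2))} (h : SpinalData m GA ω)
    (hreg : ∀ a ∈ GA, ∀ y z : Fin (m + 2),
      Function.minimalPeriod (⇑a) y = Function.minimalPeriod (⇑a) z) (b : GB) :
    HasPowOrder (m + 2) (spinalHom m ω b) := by
  have hb : b ^ (m + 2) = 1 := h.kernels_sep 0 _ fun j _ => by
    rw [map_pow, h.pow_eq_one hreg (h.map_mem j b)]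
  exact ⟨1, by rw [pow_one, ← map_pow, hb, map_one]⟩

theorem IsWordOver.wordPerm_mem {B : Type*} {m : ℕ} {GA : Subgroup (Equiv.Perm (Fin (m + 2)))}
    {F : List (Letter m B)} (hF : IsWordOver GA F) : wordPerm F ∈ GA := by
  refine Subgroup.list_prod_mem _ fun c hc => ?_
  obtain ⟨x, hx, rfl⟩ := List.mem_map.1 hc
  rcases x with a | b
  · exact hF a hx
  · exact GA.one_mem

theorem IsWordOver.append {B : Type*} {m : ℕ} {GA : Subgroup (Equiv.Perm (Fin (m + 2)))}
    {F F' : List (Letter m B)} (hF : IsWordOver GA F) (hF' : IsWordOver GA F') :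
    IsWordOver GA (F ++ F') := fun a ha =>
  (List.mem_append.1 ha).elim (hF a) (hF' a)

theorem SpinalData.isWordOver_powSection {m : ℕ} {GA : Subgroup (Equiv.Perm (Fin (m + 2)))}
    {ω : ℕ → GB →* Equiv.Perm (Fin (m + 2))} (h : SpinalData m GA ω)
    (F : List (Letter m GB)) (n : ℕ) (y : Fin (m + 2)) :
    IsWordOver GA (powSection (ω 0) F n y) := by
  have hletter : ∀ (x : Letter m GB) (y : Fin (m + 2)),
      IsWordOver GA (letterSection (ω 0) x y) := by
    rintro (c | b) y a ha
    · simp [letterSection] at ha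
    · simp only [letterSection] at ha
      split_ifs at ha
      · simp at ha
      · obtain rfl : a = ω 0 b := by simpa using ha
        exact h.map_mem 0 b
      · simp at ha
  have hword : ∀ (F : List (Letter m GB)) (y : Fin (m + 2)),
      IsWordOver GA (wordSection (ω 0) F y) := by
    intro F y
    induction F with
    | nil => simp [IsWordOver, wordSection]
    | cons x F ih => exact (hletter x _).append ih
  induction n with
  | zero => simp [IsWordOver, powSection]
  | succ n ih => exact (hword F _).append ih

theorem countP_powSection {m : ℕ} (ω0 : GB →* Equiv.Perm (Fin (m + 2)))
    (F : List (Letter m GB)) (p : Letter m GB → Bool) (n : ℕ) (y : Fin (m + 2)) :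
    (powSection ω0 F n y).countP p =
      ∑ t ∈ Finset.range n, (wordSection ω0 F ((wordPerm F ^ t) y)).countP p := by
  induction n with
  | zero => simp [powSection]
  | succ n ih => rw [powSection, List.countP_append, ih, Finset.sum_range_succ, add_comm]

/-- If each letter satisfying `p'` contributes at most one letter satisfying `p`, and only at the
vertex `z`, then along a set of distinct vertices the sections have no more `p`-letters than
the word has `p'`-letters. -/
theorem sum_countP_wordSection_le {m : ℕ} (ω0 : GB →* Equiv.Perm (Fin (m + 2)))
    (p p' : Letter m GB → Bool) (z : Fin (m + 2))
    (hp : ∀ x y, (letterSection ω0 x y).countP p ≤ if p' x ∧ y = z then 1 else 0)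
    {s : Finset ℕ} {v : ℕ → Fin (m + 2)} (hv : Set.InjOn v s) (F : List (Letter m GB)) :
    ∑ t ∈ s, (wordSection ω0 F (v t)).countP p ≤ F.countP p' := by
  induction F with
  | nil => simp [wordSection]
  | cons x F ih =>
    simp only [wordSection, List.countP_append, Finset.sum_add_distrib, List.countP_cons]
    rw [add_comm]
    refine add_le_add ih ((Finset.sum_le_sum fun t _ => hp x (wordPerm F (v t))).trans ?_)
    by_cases hx : p' x
    · simp only [hx, true_and, if_true, Finset.sum_boole]
      refine Finset.card_le_one.2 fun i hi j hj => ?_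
      rw [Finset.mem_filter] at hi hj
      exact hv hi.1 hj.1 ((wordPerm F).injective (hi.2.trans hj.2.symm))
    · simp [hx]

theorem countP_powSection_le {m : ℕ} (ω0 : GB →* Equiv.Perm (Fin (m + 2)))
    (p p' : Letter m GB → Bool) (z : Fin (m + 2))
    (hp : ∀ x y, (letterSection ω0 x y).countP p ≤ if p' x ∧ y = z then 1 else 0)
    (F : List (Letter m GB)) (y : Fin (m + 2)) :
    (powSection ω0 F (Function.minimalPeriod (wordPerm F) y) y).countP p ≤ F.countP p' := by
  rw [countP_powSection]
  refine sum_countP_wordSection_le ω0 p p' z hp (v := fun t => (wordPerm F ^ t) y) ?_ F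
  intro i hi j hj hij
  simp only [Equiv.Perm.coe_pow] at hij
  exact Function.iterate_injOn_Iio_minimalPeriod (by simpa using hi) (by simpa using hj) hij

theorem countP_isRight_powSection_le {m : ℕ} (ω0 : GB →* Equiv.Perm (Fin (m + 2)))
    (F : List (Letter m GB)) (y : Fin (m + 2)) :
    (powSection ω0 F (Function.minimalPeriod (wordPerm F) y) y).countP (·.isRight) ≤
      F.countP (·.isRight) := by
  refine countP_powSection_le ω0 _ _ (qtop m) ?_ F y
  rintro (a | b) y
  · simp [letterSection]
  · simp only [letterSection]
    split_ifs <;> simp_all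

open scoped Classical in
theorem countP_isRight_powSection_lt {m : ℕ} (ω0 : GB →* Equiv.Perm (Fin (m + 2)))
    (F : List (Letter m GB)) (y : Fin (m + 2)) {b : GB} (hb : Sum.inr b ∈ F)
    (hb' : Sum.inr b ∉ powSection ω0 F (Function.minimalPeriod (wordPerm F) y) y) :
    (powSection ω0 F (Function.minimalPeriod (wordPerm F) y) y).countP (·.isRight) <
      F.countP (·.isRight) := by
  have hle := countP_powSection_le ω0
    (fun x => x.isRight && decide (x ≠ Sum.inr b)) (fun x => x.isRight && decide (x ≠ Sum.inr b))
    (qtop m) (by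
      rintro (a | c) y
      · simp [letterSection]
      · simp only [letterSection]
        split_ifs <;> simp_all) F y
  refine lt_of_eq_of_lt (List.countP_congr fun x hx => ?_) (hle.trans_lt ?_)
  · have : x ≠ Sum.inr b := fun h => hb' (h ▸ hx)
    simp [this]
  · exact countP_lt_countP_of_imp hb (by simp) (by simp) (by simp)

open scoped Classical in
theorem countP_isLeft_powSection_lt {m : ℕ} (ω0 : GB →* Equiv.Perm (Fin (m + 2)))
    (F : List (Letter m GB)) (y : Fin (m + 2)) {b : GB} (hb : Sum.inr b ∈ F) (hω : ω0 b = 1) :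
    (powSection ω0 F (Function.minimalPeriod (wordPerm F) y) y).countP (·.isLeft) <
      F.countP (·.isRight) := by
  have hle := countP_powSection_le ω0 (·.isLeft)
    (Sum.elim (fun _ => false) fun c => decide (ω0 c ≠ 1)) (qone m) (by
      rintro (a | c) y
      · simp [letterSection]
      · simp only [letterSection]
        split_ifs <;> simp_all) F y
  refine hle.trans_lt (countP_lt_countP_of_imp hb ?_ (by simp) (by simp [hω]))
  rintro (a | c) <;> simp

/-- A word is either a single spinal element or can be rewritten with at most one `B`-letter per
`A`-letter, up to a `B`-letter in front. -/
theorem exists_evalWord_eq {m : ℕ} (GA : Subgroup (Equiv.Perm (Fin (m + 2))))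
    (ω : ℕ → GB →* Equiv.Perm (Fin (m + 2))) (F : List (Letter m GB)) (hF : IsWordOver GA F) :
    (∃ b, evalWord m ω F = spinalHom m ω b) ∨
      ∃ F' b₀ b, IsWordOver GA F' ∧ F'.countP (·.isRight) + 1 ≤ F.countP (·.isLeft) ∧
        evalWord m ω F = spinalHom m ω b₀ * evalWord m ω F' * spinalHom m ω b := by
  induction F with
  | nil => exact Or.inl ⟨1, by simp⟩
  | cons x F ih =>
    have ih := ih fun a ha => hF a (List.mem_cons_of_mem _ ha)
    rcases x with a | c
    · have ha : a ∈ GA := hF a List.mem_cons_self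
      right
      rcases ih with ⟨b, hb⟩ | ⟨F', b₀, b, hF', hle, hb⟩
      · refine ⟨[Sum.inl a], 1, b, ?_, by simp, by simp [hb, evalLetter_inl]⟩
        intro a' ha'
        obtain rfl : a' = a := by simpa using ha'
        exact ha
      · refine ⟨Sum.inl a :: Sum.inr b₀ :: F', 1, b, ?_, by
          simp only [List.countP_cons, Sum.isRight_inl, Sum.isRight_inr, Sum.isLeft_inl, if_true,
            Bool.false_eq_true, if_false]
          omega, by simp [hb, evalLetter_inl, evalLetter_inr, mul_assoc]⟩
        intro a' ha'
        rcases (by simpa using ha' : a' = a ∨ Sum.inl a' ∈ F') with rfl | h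
        exacts [ha, hF' a' h]
    · rcases ih with ⟨b, hb⟩ | ⟨F', b₀, b, hF', hle, hb⟩
      · exact Or.inl ⟨c * b, by simp [hb, evalLetter_inr]⟩
      · exact Or.inr ⟨F', c * b₀, b, hF', by simpa using hle,
          by simp [hb, evalLetter_inr, mul_assoc]⟩

theorem evalWord_eq_rootHom {m : ℕ} (ω : ℕ → GB →* Equiv.Perm (Fin (m + 2)))
    (F : List (Letter m GB)) (hF : F.countP (·.isRight) = 0) :
    evalWord m ω F = rootHom m (wordPerm F) := by
  induction F with
  | nil => simp [wordPerm]
  | cons x F ih =>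
    rcases x with a | b
    · rw [evalWord_cons, ih (by simpa using hF), evalLetter_inl, ← map_mul]
      simp [wordPerm]
    · simp at hF

theorem SpinalData.hasPowOrder_of_powSection {m : ℕ} {GA : Subgroup (Equiv.Perm (Fin (m + 2)))}
    {ω : ℕ → GB →* Equiv.Perm (Fin (m + 2))} (h : SpinalData m GA ω)
    (hreg : ∀ a ∈ GA, ∀ y z : Fin (m + 2),
      Function.minimalPeriod (⇑a) y = Function.minimalPeriod (⇑a) z)
    {F : List (Letter m GB)} (hF : IsWordOver GA F)
    (hsec : ∀ y, HasPowOrder (m + 2) (evalWord m (fun j => ω (j + 1))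
      (powSection (ω 0) F (Function.minimalPeriod (wordPerm F) y) y))) :
    HasPowOrder (m + 2) (evalWord m ω F) := by
  set d := Function.minimalPeriod (wordPerm F) 0 with hd
  have hper : ∀ y, Function.minimalPeriod (wordPerm F) y = d := fun y =>
    hreg _ hF.wordPerm_mem y 0
  have hpow : wordPerm F ^ d = 1 := by
    ext1 y
    rw [Equiv.Perm.coe_pow, ← hper y]
    exact Function.iterate_minimalPeriod
  have hdvd : d ∣ m + 2 := by
    refine Function.IsPeriodicPt.minimalPeriod_dvd ?_
    change (wordPerm F)^[m + 2] 0 = 0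
    rw [← Equiv.Perm.coe_pow, h.pow_eq_one hreg hF.wordPerm_mem, Equiv.Perm.one_apply]
  simp only [hper] at hsec
  choose k hk using hsec
  obtain ⟨e, he⟩ := hdvd
  have hK : (evalWord m ω F ^ d) ^ (m + 2) ^ (∑ y, k y) = 1 := by
    have hcons : ∀ (n : ℕ) (y : Fin (m + 2)) (w : List (Fin (m + 2))),
        ((evalWord m ω F ^ d) ^ n) (y :: w) = y :: (evalWord m (fun j => ω (j + 1))
          (powSection (ω 0) F d y) ^ n) w := by
      intro n y w
      induction n with
      | zero => rfl
      | succ n ih =>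
        rw [pow_succ', Equiv.Perm.mul_apply, ih, evalWord_pow_apply_cons, hpow, pow_succ']
        rfl
    have hnil : ∀ n : ℕ, (evalWord m ω F ^ n) [] = [] := by
      intro n
      induction n with
      | zero => rfl
      | succ n ih => rw [pow_succ', Equiv.Perm.mul_apply, ih, evalWord_apply_nil]
    ext1 w
    cases w with
    | nil => rw [← pow_mul, hnil]; rfl
    | cons y w =>
      obtain ⟨c, hc⟩ := Nat.pow_dvd_pow (m + 2)
        (Finset.single_le_sum (fun _ _ => Nat.zero_le _) (Finset.mem_univ y) : k y ≤ ∑ y, k y)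
      rw [hcons, hc, pow_mul, hk, one_pow]
      rfl
  refine ⟨(∑ y, k y) + 1, ?_⟩
  have : (m + 2) ^ ((∑ y, k y) + 1) = d * (m + 2) ^ (∑ y, k y) * e := by
    rw [pow_succ]
    conv_lhs => rw [← Nat.mul_comm]
    conv_lhs => lhs; rw [he]
    ring
  rw [this, pow_mul, pow_mul, hK, one_pow]

theorem SpinalData.hasPowOrder_evalWord {m : ℕ} {GA : Subgroup (Equiv.Perm (Fin (m + 2)))}
    (hreg : ∀ a ∈ GA, ∀ y z : Fin (m + 2),
      Function.minimalPeriod (⇑a) y = Function.minimalPeriod (⇑a) z)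
    {ω : ℕ → GB →* Equiv.Perm (Fin (m + 2))} (h : SpinalData m GA ω)
    (F : List (Letter m GB)) (hF : IsWordOver GA F) :
    HasPowOrder (m + 2) (evalWord m ω F) := by
  induction hk : F.countP (·.isRight) using Nat.strong_induction_on generalizing ω F with
  | _ k ihk =>
  by_cases hB : ∃ b, Sum.inr b ∈ F
  · obtain ⟨b, hb⟩ := hB
    obtain ⟨r, -, hr⟩ := h.kernels_cover 0 b
    induction r generalizing ω F with
    | zero =>
      refine h.hasPowOrder_of_powSection hreg hF fun y => ?_
      have hlt := countP_isLeft_powSection_lt (ω 0) F y hb hr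
      rcases exists_evalWord_eq GA (fun j => ω (j + 1)) _
        (h.isWordOver_powSection F (Function.minimalPeriod (wordPerm F) y) y) with
        ⟨c, hc⟩ | ⟨F', b₀, c, hF', hle, hc⟩
      · rw [hc]
        exact h.shift.hasPowOrder_spinalHom hreg c
      · rw [hc]
        refine HasPowOrder.of_conj (c := (spinalHom m (fun j => ω (j + 1)) b₀)⁻¹) ?_
        have := ihk _ ?_ h.shift (F' ++ [Sum.inr (c * b₀)])
          (hF'.append fun a ha => by simp at ha) rfl
        · simpa [evalLetter_inr, mul_assoc] using this
        · simp only [List.countP_append, List.countP_singleton, Sum.isRight_inr, if_true]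
          omega
    | succ r ihr =>
      refine h.hasPowOrder_of_powSection hreg hF fun y => ?_
      have hover := h.isWordOver_powSection F (Function.minimalPeriod (wordPerm F) y) y
      have hle := countP_isRight_powSection_le (ω 0) F y
      by_cases hlt : (powSection (ω 0) F (Function.minimalPeriod (wordPerm F) y) y).countP
          (·.isRight) < k
      · exact ihk _ hlt h.shift _ hover rfl
      · refine ihr h.shift _ hover (by omega) ?_ hr
        by_contra hb'
        exact hlt (hk ▸ countP_isRight_powSection_lt (ω 0) F y hb hb')
  · have h0 : F.countP (·.isRight) = 0 := by
      rw [List.countP_eq_zero]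
      rintro (a | b) hx
      · simp
      · exact absurd ⟨b, hx⟩ hB
    exact ⟨1, by rw [evalWord_eq_rootHom ω F h0, pow_one, ← map_pow,
      h.pow_eq_one hreg hF.wordPerm_mem, map_one]⟩

theorem exists_evalWord_of_mem_spinalGroup {m : ℕ} {GA : Subgroup (Equiv.Perm (Fin (m + 2)))}
    {ω : ℕ → GB →* Equiv.Perm (Fin (m + 2))} {g : Equiv.Perm (List (Fin (m + 2)))}
    (hg : g ∈ spinalGroup m GA ω) : ∃ F, IsWordOver GA F ∧ evalWord m ω F = g := by
  have hsingle : ∀ a ∈ GA, IsWordOver GA [(Sum.inl a : Letter m GB)] := by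
    intro a ha a' ha'
    obtain rfl : a' = a := by simpa using ha'
    exact ha
  have hspinal : ∀ b : GB, IsWordOver GA [(Sum.inr b : Letter m GB)] :=
    fun b a ha => by simp at ha
  induction hg using Subgroup.closure_induction with
  | mem x hx =>
    rcases hx.1 with ⟨a, ha, rfl⟩ | ⟨b, rfl⟩
    · exact ⟨_, hsingle a ha, by simp [evalLetter]⟩
    · exact ⟨_, hspinal b, by simp [evalLetter]⟩
  | one => exact ⟨[], by simp [IsWordOver], rfl⟩
  | mul x y _ _ hx hy =>
    obtain ⟨F, hF, rfl⟩ := hx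
    obtain ⟨F', hF', rfl⟩ := hy
    exact ⟨F ++ F', hF.append hF', by simp⟩
  | inv x hmem hx =>
    obtain ⟨F, hF, rfl⟩ := hx
    clear hmem
    induction F with
    | nil => exact ⟨[], hF, by simp⟩
    | cons x F ih =>
      obtain ⟨F', hF', he⟩ := ih fun a ha => hF a (List.mem_cons_of_mem _ ha)
      rcases x with a | b
      · exact ⟨F' ++ [Sum.inl a⁻¹], hF'.append (hsingle _ (GA.inv_mem (hF a List.mem_cons_self))),
          by simp [he, evalLetter_inl]⟩
      · exact ⟨F' ++ [Sum.inr b⁻¹], hF'.append (hspinal _), by simp [he, evalLetter_inr]⟩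

/-- If the action of `G_A` on `Y` is regular (all cycles of each induced permutation have
the same length), then for every `ω ∈ Ω̂` the spinal group `G_ω` is periodic; moreover the
order of every element divides some power of `q`. -/
theorem spinalGroup_periodic (m : ℕ) (GA : Subgroup (Equiv.Perm (Fin (m + 2))))
    {GB : Type*} [Group GB] [Finite GB] (ω : ℕ → GB →* Equiv.Perm (Fin (m + 2)))
    (hdata : SpinalData m GA ω)
    (hreg : ∀ a ∈ GA, ∀ y z : Fin (m + 2),
      Function.minimalPeriod (⇑a) y = Function.minimalPeriod (⇑a) z) :
    ∀ g ∈ spinalGroup m GA ω, ∃ k : ℕ, g ^ ((m + 2) ^ k) = 1 := by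
  intro g hg
  obtain ⟨F, hF, rfl⟩ := exists_evalWord_of_mem_spinalGroup hg
  exact hdata.hasPowOrder_evalWord hreg F hF
end Spinal
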